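/- Let S ∈ ℝ^{1×n₁}, T ∈ ℝ^{m×n₂} with m ≥ 2, and let A = S × T ∈ ℝ^{m×(n₁+n₂)} be the matrix whose i-th row is the concatenation of S and T[i,:]. For i ∈ {2,…,m} let R_i = Giv_m(1, i, −1/√i, √(i−1)/√i) and let G = R_m ⋯ R_2. Then G·A equals the block matrix with first row [√m·S H(T)] and remaining m−1 rows [0^{(m−1)×n₁} T(T)], where H(T) is the head and T(T) the tail of T. -/

import Mathlib

open Matrix

/-- The head `H(A)` of a matrix `A ∈ ℝ^{m×n}`: the row `(1/√m) ∑_{i=1}^m A[i,:]`. -/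
noncomputable def headM {m n : ℕ} (A : Matrix (Fin m) (Fin n) ℝ) : Fin n → ℝ :=
  fun c => (1 / Real.sqrt m) * ∑ i, A i c

/-- The tail `T(A)` of a matrix `A ∈ ℝ^{m×n}`: for (1-based) `j ∈ [m-1]`, its `j`-th row is
`(1/√(j+1)) (√j · A[j+1,:] − (∑_{i=1}^j A[i,:])/√j)`. Rows are 0-indexed, so the row of
index `j : Fin (m-1)` corresponds to the 1-based index `j+1`. -/
noncomputable def tailM {m n : ℕ} (A : Matrix (Fin m) (Fin n) ℝ) :
    Matrix (Fin (m - 1)) (Fin n) ℝ :=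
  fun j c =>
    (1 / Real.sqrt ((j.val : ℝ) + 2)) *
      (Real.sqrt ((j.val : ℝ) + 1) * A ⟨j.val + 1, by have := j.isLt; omega⟩ c -
        (∑ i ∈ Finset.univ.filter (fun i : Fin m => i.val < j.val + 1), A i c) /
          Real.sqrt ((j.val : ℝ) + 1))

/-- `pnorm v j` is the ℓ2 norm of the first `j` entries of `v`, i.e. `‖v[1..j]‖`.
In particular `pnorm v m = ‖v‖`. -/
noncomputable def pnorm {m : ℕ} (v : Fin m → ℝ) (j : ℕ) : ℝ :=
  Real.sqrt (∑ i ∈ Finset.univ.filter (fun i : Fin m => i.val < j), v i ^ 2)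

/-- The generalized head `H(A, v) = (1/‖v‖) ∑_{i=1}^m v[i] · A[i,:]`. -/
noncomputable def gHead {m n : ℕ} (A : Matrix (Fin m) (Fin n) ℝ) (v : Fin m → ℝ) :
    Fin n → ℝ :=
  fun c => (1 / pnorm v m) * ∑ i, v i * A i c

/-- The generalized tail `T(A, v)`: for (1-based) `j ∈ [m-1]`, its `j`-th row is
`(1/‖v[1..j+1]‖)(‖v[1..j]‖ · A[j+1,:] − v[j+1] · (∑_{i=1}^j v[i] A[i,:])/‖v[1..j]‖)`. -/
noncomputable def gTail {m n : ℕ} (A : Matrix (Fin m) (Fin n) ℝ) (v : Fin m → ℝ) :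
    Matrix (Fin (m - 1)) (Fin n) ℝ :=
  fun j c =>
    (1 / pnorm v (j.val + 2)) *
      (pnorm v (j.val + 1) * A ⟨j.val + 1, by have := j.isLt; omega⟩ c -
        v ⟨j.val + 1, by have := j.isLt; omega⟩ *
          (∑ i ∈ Finset.univ.filter (fun i : Fin m => i.val < j.val + 1), v i * A i c) /
          pnorm v (j.val + 1))

/-- The `d`-dimensional Givens rotation matrix `Giv_d(i, j, s, c)`. -/
noncomputable def Givens (d : ℕ) (i j : Fin d) (s c : ℝ) : Matrix (Fin d) (Fin d) ℝ :=
  fun k l =>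
    if k = i ∧ l = i then c
    else if k = j ∧ l = j then c
    else if k = i ∧ l = j then -s
    else if k = j ∧ l = i then s
    else if k = l then 1 else 0

theorem Givens_mulVec_apply {d : ℕ} {i j : Fin d} (hij : i ≠ j) (s c : ℝ) (x : Fin d → ℝ)
    (k : Fin d) :
    (Givens d i j s c *ᵥ x) k =
      if k = i then c * x i - s * x j else if k = j then s * x i + c * x j else x k := by
  have hrow : ∀ l, Givens d i j s c k l * x l =
      if k = i then (if l = i then c * x i else 0) + (if l = j then -s * x j else 0)
      else if k = j then (if l = i then s * x i else 0) + (if l = j then c * x j else 0)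
      else if l = k then x k else 0 := by
    intro l
    unfold Givens
    grind
  simp only [mulVec, dotProduct, hrow]
  split_ifs <;> simp [Finset.sum_add_distrib, sub_eq_add_neg]

theorem Finset.sum_filter_val_lt_succ {m : ℕ} (a : Fin m → ℝ) {k : ℕ} (hk : k < m) :
    ∑ i ∈ Finset.univ.filter (fun i : Fin m => i.val < k + 1), a i =
      (∑ i ∈ Finset.univ.filter (fun i : Fin m => i.val < k), a i) + a ⟨k, hk⟩ := by
  have : Finset.univ.filter (fun i : Fin m => i.val < k + 1) =
      insert ⟨k, hk⟩ (Finset.univ.filter (fun i : Fin m => i.val < k)) := by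
    ext i
    simp [Fin.ext_iff]
    omega
  rw [this, Finset.sum_insert (by simp), add_comm]

/-- The rotation that merges row `t + 1` into row `0` of a matrix whose row `0` is the normalized
sum of the rows `0, …, t`. -/
noncomputable def headRotation {m : ℕ} (t : Fin (m - 1)) : Matrix (Fin m) (Fin m) ℝ :=
  Givens m ⟨0, by have := t.isLt; omega⟩ ⟨t.val + 1, by have := t.isLt; omega⟩
    (-(1 / Real.sqrt ((t.val : ℝ) + 2)))
    (Real.sqrt ((t.val : ℝ) + 1) / Real.sqrt ((t.val : ℝ) + 2))

/-- Applying the first `k` rotations produces the head and the tail of the first `k + 1` entries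
and leaves the other entries unchanged. -/
theorem headRotation_take_prod_mulVec {m : ℕ} (a : Fin m → ℝ) {k : ℕ} (hk : k ≤ m - 1)
    (i : Fin m) :
    ((((List.ofFn (headRotation (m := m))).take k).reverse).prod *ᵥ a) i =
      if i.val = 0 then
        (1 / Real.sqrt ((k : ℝ) + 1)) *
          ∑ l ∈ Finset.univ.filter (fun l : Fin m => l.val < k + 1), a l
      else if k < i.val then a i
      else (1 / Real.sqrt (((i.val - 1 : ℕ) : ℝ) + 2)) *
        (Real.sqrt (((i.val - 1 : ℕ) : ℝ) + 1) * a i -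
          (∑ l ∈ Finset.univ.filter (fun l : Fin m => l.val < i.val), a l) /
            Real.sqrt (((i.val - 1 : ℕ) : ℝ) + 1)) := by
  have hm : 0 < m := i.pos
  induction k generalizing i with
  | zero =>
    have h0 := Finset.sum_filter_val_lt_succ a hm
    rcases Nat.eq_zero_or_pos i.val with h | h
    · have : i = ⟨0, hm⟩ := Fin.ext h
      simp only [List.take_zero, List.reverse_nil, List.prod_nil, one_mulVec, h0]
      simp [this]
    · simp [h, h.ne']
  | succ k ih =>
    have hkm : k < m - 1 := hk
    have hk1 : k + 1 < m := by omega
    have hlist : (List.ofFn (headRotation (m := m))).take (k + 1) =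
        (List.ofFn (headRotation (m := m))).take k ++ [headRotation ⟨k, hkm⟩] := by
      rw [List.take_add_one]
      simp [hkm]
    rw [hlist, List.reverse_append, List.reverse_singleton, List.singleton_append,
      List.prod_cons, ← mulVec_mulVec]
    rw [headRotation, Givens_mulVec_apply (by simp [Fin.ext_iff])]
    have ih0 := ih (by omega) ⟨0, hm⟩
    have ih1 := ih (by omega) ⟨k + 1, hk1⟩
    have ihi := ih (by omega) i
    simp only [if_true, Nat.lt_succ_self, Nat.succ_ne_zero, if_false] at ih0 ih1
    rw [ih0, ih1, ihi]
    have hp1 : (0 : ℝ) < Real.sqrt ((k : ℝ) + 1) := by positivity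
    have hp2 : (0 : ℝ) < Real.sqrt ((k : ℝ) + 2) := by positivity
    by_cases h0 : i.val = 0
    · rw [if_pos (Fin.ext h0), if_pos h0, Finset.sum_filter_val_lt_succ a hk1]
      have : ((k + 1 : ℕ) : ℝ) + 1 = (k : ℝ) + 2 := by push_cast; ring
      rw [this]
      field_simp
      ring
    · rw [if_neg (fun h => h0 (congrArg Fin.val h)), if_neg h0]
      by_cases h1 : i.val = k + 1
      · obtain rfl : i = ⟨k + 1, hk1⟩ := Fin.ext h1
        simp only [if_true, Nat.succ_ne_zero, lt_irrefl, if_false, Nat.add_sub_cancel]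
        field_simp
        ring
      · rw [if_neg (fun h => h1 (congrArg Fin.val h)), if_neg h0]
        by_cases h2 : k < i.val
        · rw [if_pos h2, if_pos (by omega)]
        · rw [if_neg h2, if_neg (by omega)]

theorem Fin.card_filter_val_lt_of_le {m k : ℕ} (hk : k ≤ m) :
    (Finset.univ.filter (fun i : Fin m => i.val < k)).card = k := by
  simp [Fin.card_filter_val_lt, hk]

/-- Lemma 1: applying the Givens rotations `R_m ⋯ R_2` to the Cartesian product
`A = S × T` yields the block matrix `[√m·S, H(T); 0, T(T)]`.
Here the rotation for 1-based index `i ∈ {2,…,m}` is indexed by `t : Fin (m-1)` with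
`i = t+2`, and rows/columns of matrices are 0-indexed. -/
theorem givens_cartesian_product {m n₁ n₂ : ℕ} (hm : 2 ≤ m)
    (S : Matrix (Fin 1) (Fin n₁) ℝ) (T : Matrix (Fin m) (Fin n₂) ℝ)
    (A : Matrix (Fin m) (Fin n₁ ⊕ Fin n₂) ℝ)
    (hA : ∀ i c, A i c = Sum.elim (fun c₁ => S 0 c₁) (fun c₂ => T i c₂) c)
    (R : Fin (m - 1) → Matrix (Fin m) (Fin m) ℝ)
    (hR : ∀ t, R t = Givens m ⟨0, by omega⟩ ⟨t.val + 1, by have := t.isLt; omega⟩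
      (-(1 / Real.sqrt ((t.val : ℝ) + 2)))
      (Real.sqrt ((t.val : ℝ) + 1) / Real.sqrt ((t.val : ℝ) + 2)))
    (G : Matrix (Fin m) (Fin m) ℝ)
    (hG : G = ((List.ofFn R).reverse).prod) :
    ∀ i c, (G * A) i c =
      if i.val = 0 then
        Sum.elim (fun c₁ => Real.sqrt m * S 0 c₁) (fun c₂ => headM T c₂) c
      else
        Sum.elim (fun _ => (0 : ℝ))
          (fun c₂ => tailM T ⟨i.val - 1, by have := i.isLt; omega⟩ c₂) c := by
  intro i c
  obtain rfl : R = headRotation := funext hR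
  have hprod := headRotation_take_prod_mulVec (fun l => A l c) le_rfl i
  rw [List.take_of_length_le (by simp), ← hG] at hprod
  have hcast : ((m - 1 : ℕ) : ℝ) + 1 = m := by
    rw [Nat.cast_sub (by omega)]
    simp
  have hall : ∀ f : Fin m → ℝ,
      ∑ l ∈ Finset.univ.filter (fun l : Fin m => l.val < m - 1 + 1), f l = ∑ l, f l := by
    intro f
    rw [Finset.filter_true_of_mem]
    intro l _
    omega
  change (G *ᵥ fun l => A l c) i = _
  rw [hprod, if_neg (show ¬ m - 1 < i.val by omega), hcast, hall]
  have hm0 : (0 : ℝ) < m := by positivity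
  by_cases h0 : i.val = 0
  · rw [if_pos h0, if_pos h0]
    rcases c with c | c
    · simp only [hA, Sum.elim_inl, Finset.sum_const, Finset.card_univ, Fintype.card_fin,
        nsmul_eq_mul]
      have := Real.sq_sqrt hm0.le
      field_simp
      rw [this]
    · simp only [hA, Sum.elim_inr, headM]
  · rw [if_neg h0, if_neg h0]
    obtain ⟨j, hj, rfl⟩ : ∃ (j : ℕ) (hj : j + 1 < m), i = ⟨j + 1, hj⟩ :=
      ⟨i.val - 1, by omega, Fin.ext (by simp only; omega)⟩
    rcases c with c | c
    · simp only [hA, Sum.elim_inl, Finset.sum_const, nsmul_eq_mul, Nat.add_sub_cancel]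
      rw [Fin.card_filter_val_lt_of_le (by omega)]
      have := Real.sq_sqrt (show (0 : ℝ) ≤ (j : ℝ) + 1 by positivity)
      push_cast
      field_simp
      rw [this]
      ring
    · simp only [hA, Sum.elim_inr, tailM, Nat.add_sub_cancel]
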